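/- Let n, k ≥ 1 and let A be an n×(n+k) complex matrix whose leftmost n×n submatrix is X. Let 0 < a < 1 and let c_1, …, c_{k+1} be positive reals such that the squares x_i = c_i² are pairwise distinct points in the interval [1−a, 1+a]. Suppose w_1, …, w_{k+1} are real numbers satisfying |w_i − Φ(A[c_i])| ≤ E for all i, where E ≥ 0. Let V be the (k+1)×(k+1) Vandermonde matrix with entries V_{i,j} = x_i^{j−1}, and let β̂ = V^{-1} w. Then the first coordinate of β̂ satisfies |β̂_1 − |Per(X)|² / C(n+k, n)| ≤ ‖V^{-1}‖_∞ · E, where ‖M‖_∞ denotes the maximum absolute row sum of M. -/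

import Mathlib

open Matrix Finset

/-- The `n × n` submatrix of an `n × (n+k)` matrix formed by the columns indexed by a
subset `S` of cardinality `n` (in increasing order). -/
noncomputable def colSub {n k : ℕ} (A : Matrix (Fin n) (Fin (n + k)) ℂ)
    (S : Finset (Fin (n + k))) (h : S.card = n) : Matrix (Fin n) (Fin n) ℂ :=
  Matrix.of fun i j => A i (S.orderIsoOfFin h j)

/-- `Φ(A) = (1/C(n+k,n)) ∑_S |Per(A_S)|²`, the sum over all `n`-element subsets of columns. -/
noncomputable def Phi {n k : ℕ} (A : Matrix (Fin n) (Fin (n + k)) ℂ) : ℝ :=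
  (1 / ((n + k).choose n : ℝ)) *
    ∑ S ∈ (Finset.powersetCard n (Finset.univ : Finset (Fin (n + k)))).attach,
      ‖(colSub A S.1 (Finset.mem_powersetCard.mp S.2).2).permanent‖ ^ 2

/-- `A[c]`: the matrix obtained from `A` by multiplying its `k` rightmost columns by `c`. -/
noncomputable def scaleCols {n k : ℕ} (c : ℝ) (A : Matrix (Fin n) (Fin (n + k)) ℂ) :
    Matrix (Fin n) (Fin (n + k)) ℂ :=
  Matrix.of fun i j => if n ≤ (j : ℕ) then (c : ℂ) * A i j else A i j

/-- Maximum absolute row sum of a square real matrix. -/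
noncomputable def rowSumNorm {d : ℕ} (M : Matrix (Fin d) (Fin d) ℝ) : ℝ :=
  ⨆ i, ∑ j, |M i j|

/-- Number of scaled columns in `S`. -/
def mcount {n k : ℕ} (S : Finset (Fin (n + k))) : ℕ := (S.filter fun j : Fin (n + k) => n ≤ (j : ℕ)).card

lemma mcount_le {n k : ℕ} (S : Finset (Fin (n + k))) : mcount S ≤ k := by
  have h1 : (S.filter fun j : Fin (n + k) => n ≤ (j : ℕ)) ⊆ (Finset.univ : Finset (Fin k)).image (Fin.natAdd n) := by
    intro j hj
    rw [Finset.mem_filter] at hj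
    rw [Finset.mem_image]
    refine ⟨⟨(j : ℕ) - n, by omega⟩, Finset.mem_univ _, ?_⟩
    ext
    simp
    omega
  calc mcount S ≤ _ := Finset.card_le_card h1
    _ ≤ _ := Finset.card_image_le
    _ = k := by simp

lemma perm_scale {n k : ℕ} (A : Matrix (Fin n) (Fin (n + k)) ℂ) (c : ℝ)
    (S : Finset (Fin (n + k))) (h : S.card = n) :
    (colSub (scaleCols c A) S h).permanent = (c : ℂ) ^ mcount S * (colSub A S h).permanent := by
  have hd : ∏ i : Fin n, (if n ≤ ((S.orderIsoOfFin h i : Fin (n + k)) : ℕ) then (c : ℂ) else 1)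
      = (c : ℂ) ^ mcount S := by
    have e1 := Equiv.prod_comp (S.orderIsoOfFin h).toEquiv
      (fun j : S => if n ≤ ((j : Fin (n + k)) : ℕ) then (c : ℂ) else 1)
    have e2 := Finset.prod_coe_sort S
      (fun j : Fin (n + k) => if n ≤ (j : ℕ) then (c : ℂ) else 1)
    refine (e1.trans e2).trans ?_
    rw [Finset.prod_ite]
    simp [mcount]
  unfold Matrix.permanent
  rw [Finset.mul_sum]
  refine Finset.sum_congr rfl fun σ _ => ?_
  rw [← hd, ← Finset.prod_mul_distrib]
  refine Finset.prod_congr rfl fun i _ => ?_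
  simp only [colSub, scaleCols, Matrix.of_apply]
  split_ifs <;> simp

lemma mcount_zero {n k : ℕ} (A : Matrix (Fin n) (Fin (n + k)) ℂ)
    (S : Finset (Fin (n + k))) (h : S.card = n)
    (hS : S = (Finset.univ : Finset (Fin n)).image (Fin.castAdd k)) :
    colSub A S h = A.submatrix id (Fin.castAdd k) := by
  have h1 : (Fin.castAdd k : Fin n → Fin (n + k)) = S.orderEmbOfFin h := by
    apply Finset.orderEmbOfFin_unique
    · intro i
      rw [hS]
      exact Finset.mem_image_of_mem _ (Finset.mem_univ _)
    · exact Fin.strictMono_castAdd k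
  ext i j
  simp only [colSub, Matrix.of_apply, Matrix.submatrix_apply, id, h1]
  simp

lemma mcount_eq_zero {n k : ℕ} (S : Finset (Fin (n + k))) (h : S.card = n) :
    mcount S = 0 ↔ S = (Finset.univ : Finset (Fin n)).image (Fin.castAdd k) := by
  constructor
  · intro h0
    apply Finset.eq_of_subset_of_card_le
    · intro j hj
      rw [mcount, Finset.card_eq_zero, Finset.filter_eq_empty_iff] at h0
      have := h0 hj
      rw [Finset.mem_image]
      exact ⟨⟨j, by omega⟩, Finset.mem_univ _, rfl⟩
    · rw [h]
      refine (Finset.card_image_le (s := (Finset.univ : Finset (Fin n))) (f := Fin.castAdd k)).trans (by simp)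
  · rintro rfl
    rw [mcount, Finset.card_eq_zero, Finset.filter_eq_empty_iff]
    intro j hj
    rw [Finset.mem_image] at hj
    obtain ⟨i, -, rfl⟩ := hj
    simp

/-- Coefficients of `Φ(A[c])` as a polynomial in `c²`. -/
noncomputable def betaCoef {n k : ℕ} (A : Matrix (Fin n) (Fin (n + k)) ℂ) (j : Fin (k + 1)) : ℝ :=
  (1 / ((n + k).choose n : ℝ)) *
    ∑ S ∈ (Finset.powersetCard n (Finset.univ : Finset (Fin (n + k)))).attach,
      if mcount S.1 = (j : ℕ) then
        ‖(colSub A S.1 (Finset.mem_powersetCard.mp S.2).2).permanent‖ ^ 2 else 0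

lemma Phi_eq {n k : ℕ} (A : Matrix (Fin n) (Fin (n + k)) ℂ) (c : ℝ) :
    Phi (scaleCols c A) = ∑ j : Fin (k + 1), (c ^ 2) ^ (j : ℕ) * betaCoef A j := by
  unfold Phi betaCoef
  simp_rw [mul_left_comm _ (1 / ((n + k).choose n : ℝ)) _]
  rw [← Finset.mul_sum]
  congr 1
  simp_rw [Finset.mul_sum]
  rw [Finset.sum_comm]
  refine Finset.sum_congr rfl fun S _ => ?_
  rw [Finset.sum_eq_single (⟨mcount S.1, Nat.lt_succ_of_le (mcount_le S.1)⟩ : Fin (k + 1))]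
  · rw [perm_scale]
    simp only [if_true, norm_mul, norm_pow, Complex.norm_real, mul_pow, Real.norm_eq_abs]
    congr 1
    rw [← pow_mul, mul_comm, pow_mul, sq_abs]
  · intro j _ hj
    rw [if_neg, mul_zero]
    intro h
    exact hj (Fin.ext h.symm)
  · intro h
    exact absurd (Finset.mem_univ _) h

lemma betaCoef_zero {n k : ℕ} (A : Matrix (Fin n) (Fin (n + k)) ℂ) :
    betaCoef A 0 = ‖(A.submatrix id (Fin.castAdd k)).permanent‖ ^ 2 / ((n + k).choose n : ℝ) := by
  have hc : ((Finset.univ : Finset (Fin n)).image (Fin.castAdd k)).card = n := by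
    rw [Finset.card_image_of_injective _ (Fin.castAdd_injective n k)]
    simp
  have hm : (Finset.univ : Finset (Fin n)).image (Fin.castAdd k) ∈
      Finset.powersetCard n (Finset.univ : Finset (Fin (n + k))) :=
    Finset.mem_powersetCard.mpr ⟨Finset.subset_univ _, hc⟩
  unfold betaCoef
  rw [Finset.sum_eq_single ⟨_, hm⟩]
  · rw [if_pos (show mcount _ = ((0 : Fin (k + 1)) : ℕ) from (mcount_eq_zero _ hc).2 rfl), mcount_zero A _ hc rfl]
    ring
  · intro S _ hS
    rw [if_neg]
    intro h
    exact hS (Subtype.ext ((mcount_eq_zero _ (Finset.mem_powersetCard.mp S.2).2).1 h))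
  · intro h
    exact absurd (Finset.mem_attach _ _) h

theorem stmt0 {n k : ℕ} (hn : 1 ≤ n) (hk : 1 ≤ k)
    (A : Matrix (Fin n) (Fin (n + k)) ℂ)
    (X : Matrix (Fin n) (Fin n) ℂ) (hX : X = A.submatrix id (Fin.castAdd k))
    (a : ℝ) (ha0 : 0 < a) (ha1 : a < 1)
    (c : Fin (k + 1) → ℝ) (hc : ∀ i, 0 < c i)
    (x : Fin (k + 1) → ℝ) (hx : ∀ i, x i = (c i) ^ 2)
    (hinj : Function.Injective x)
    (hmem : ∀ i, x i ∈ Set.Icc (1 - a) (1 + a))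
    (w : Fin (k + 1) → ℝ) (E : ℝ) (hE : 0 ≤ E)
    (hw : ∀ i, |w i - Phi (scaleCols (c i) A)| ≤ E) :
    |((Matrix.vandermonde x)⁻¹).mulVec w 0 -
        ‖X.permanent‖ ^ 2 / ((n + k).choose n : ℝ)| ≤
      rowSumNorm (Matrix.vandermonde x)⁻¹ * E := by
  have hV : IsUnit (Matrix.vandermonde x).det :=
    isUnit_iff_ne_zero.mpr (Matrix.det_vandermonde_ne_zero_iff.mpr hinj)
  have hPhi : (Matrix.vandermonde x).mulVec (betaCoef A) = fun i => Phi (scaleCols (c i) A) := by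
    funext i
    rw [Phi_eq, ← hx i]
    rfl
  have hb : (Matrix.vandermonde x)⁻¹.mulVec (fun i => Phi (scaleCols (c i) A)) = betaCoef A := by
    rw [← hPhi, Matrix.mulVec_mulVec, Matrix.nonsing_inv_mul _ hV, Matrix.one_mulVec]
  rw [hX, ← betaCoef_zero A, ← hb, ← Pi.sub_apply, ← Matrix.mulVec_sub]
  have hs : ∑ j, |(Matrix.vandermonde x)⁻¹ 0 j| ≤ rowSumNorm (Matrix.vandermonde x)⁻¹ :=
    le_ciSup (f := fun i => ∑ j, |(Matrix.vandermonde x)⁻¹ i j|) (Set.finite_range _).bddAbove 0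
  refine le_trans ?_ (mul_le_mul_of_nonneg_right hs hE)
  rw [Finset.sum_mul]
  simp only [Matrix.mulVec, dotProduct]
  refine (Finset.abs_sum_le_sum_abs _ _).trans (Finset.sum_le_sum fun j _ => ?_)
  rw [abs_mul]
  exact mul_le_mul_of_nonneg_left (hw j) (abs_nonneg _)
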